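/- The inductive limit of the system of abelian groups {ℤ^{m(l+1)}/(M_{l,l+1}^t − I_{l,l+1}^t)ℤ^{m(l)}}_{l ≥ 1}, with connecting homomorphisms induced by the matrices I_{l+1,l+2}^t, is isomorphic to ℤ ⊕ (⊕_{n∈ℕ} C(𝒦,ℤ)). (This inductive limit is the group K_0 of the nonnegative matrix system (M,I) of the Cantor horizon λ-graph system of the Fibonacci Dyck shift, hence K_0 of the C*-algebra O_{𝔏^{Ch(D_F)}}.) -/

import Mathlib

noncomputable section



open Finset

/-- Admissibility for the golden-mean (Fibonacci) shift: words over the alphabet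
`{1,2}` (coded as `Fin 2`, where `0` codes the letter `1` and `1` codes the letter `2`)
with no two consecutive letters equal to `2`. -/
def DyckAdm (l : ℕ) (w : Fin l → Fin 2) : Prop :=
  ∀ i j : Fin l, (j : ℕ) = (i : ℕ) + 1 → ¬(w i = 1 ∧ w j = 1)

instance (l : ℕ) : DecidablePred (DyckAdm l) := fun w => by
  unfold DyckAdm; infer_instance

/-- The set `W_l` of admissible words of length `l`. -/
def Wset (l : ℕ) : Finset (Fin l → Fin 2) := univ.filter (DyckAdm l)

/-- `m(l)`, the number of admissible words of length `l`. -/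
def mW (l : ℕ) : ℕ := (Wset l).card

/-- Lexicographic (from the left) strict order on words. -/
def lexLt (l : ℕ) (u w : Fin l → Fin 2) : Prop :=
  ∃ i : Fin l, (∀ j : Fin l, j < i → u j = w j) ∧ u i < w i

instance (l : ℕ) : DecidableRel (lexLt l) := fun u w => by
  unfold lexLt; infer_instance

/-- The (1-based) position of an admissible word in the lexicographic ordering of `W_l`,
identifying `W_l` with `{1, …, m(l)}`. -/
def rankW (l : ℕ) (w : Fin l → Fin 2) : ℕ :=
  1 + ((Wset l).filter (fun u => lexLt l u w)).card

/-- The matrix `I_{l,l+1}` (1-based indices, entries outside `{1,…,m(l)} × {1,…,m(l+1)}`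
are `0`): `I_{l,l+1}(w,w') = 1` iff the word `w'` with its last letter deleted is `w`. -/
def Imat (l : ℕ) : ℕ → ℕ → ℤ := fun i j =>
  if ∃ w ∈ Wset l, ∃ w' ∈ Wset (l + 1),
      rankW l w = i ∧ rankW (l + 1) w' = j ∧ (∀ k : Fin l, w k = w' k.castSucc)
  then 1 else 0

/-- The matrix `M_{l,l+1}` (1-based indices):
`M_{l,l+1}(w,w') = |{k ∈ {1,2} : w' = k·w}| + ε(w,w')`, where `ε(w,w') = 1` iff
`F(w_1,w'_1) = 1` and `(w_2,…,w_l) = (w'_1,…,w'_{l-1})`; `M_{0,1} = [3 2]`.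
(Here `F(a,b) = 0` iff both letters are `2`, i.e. both codes are `1`.) -/
def Mmat : ℕ → ℕ → ℕ → ℤ
  | 0, i, j => if i = 1 ∧ j = 1 then 3 else if i = 1 ∧ j = 2 then 2 else 0
  | (l + 1), i, j =>
      ∑ w ∈ Wset (l + 1), ∑ w' ∈ Wset (l + 2),
        if rankW (l + 1) w = i ∧ rankW (l + 2) w' = j then
          ((if (∀ t : Fin (l + 1), w' t.succ = w t) then (1 : ℤ) else 0) +
           (if (¬(w 0 = 1 ∧ w' 0 = 1)) ∧
               (∀ t : Fin (l + 1), (t : ℕ) ≠ 0 →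
                 w t = w' ⟨(t : ℕ) - 1,
                   (Nat.sub_le _ _).trans_lt (t.isLt.trans (Nat.lt_succ_self _))⟩)
            then (1 : ℤ) else 0))
        else 0

/-- The matrices `S_l` (of size `m(l-1) × m(l+1)`, 1-based indices):
`S_0 = [1 1]`, `S_1 = [1 1 1]`, `S_{l+2} = [[S_{l+1}, 0], [0, S_l]]` (block diagonal). -/
def Smat : ℕ → ℕ → ℕ → ℤ
  | 0, i, j => if i = 1 ∧ (1 ≤ j ∧ j ≤ 2) then 1 else 0
  | 1, i, j => if i = 1 ∧ (1 ≤ j ∧ j ≤ 3) then 1 else 0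
  | (l + 2), i, j =>
      if i ≤ mW l then (if j ≤ mW (l + 2) then Smat (l + 1) i j else 0)
      else (if j ≤ mW (l + 2) then 0 else Smat l (i - mW l) (j - mW (l + 2)))

/-- The matrix `𝔸_{l+1,l} = M_{l,l+1}^t − I_{l,l+1}^t` (1-based indices). -/
def AmatN (l : ℕ) : ℕ → ℕ → ℤ := fun i j => Mmat l j i - Imat l j i

/-- `𝔸_{l+1,l} = M_{l,l+1}^t − I_{l,l+1}^t` as an `m(l+1) × m(l)` matrix over `Fin` types. -/
def AMat (l : ℕ) : Matrix (Fin (mW (l + 1))) (Fin (mW l)) ℤ :=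
  fun i j => AmatN l ((i : ℕ) + 1) ((j : ℕ) + 1)

/-- `𝔸_{l+1,l} = M_{l,l+1}^t − I_{l,l+1}^t` as an additive map `ℤ^{m(l)} → ℤ^{m(l+1)}`. -/
def Aadd (l : ℕ) : (Fin (mW l) → ℤ) →+ (Fin (mW (l + 1)) → ℤ) :=
  (AMat l).mulVecLin.toAddMonoidHom

/-- `I_{l,l+1}^t` as an additive map `ℤ^{m(l)} → ℤ^{m(l+1)}`. -/
def ITadd (l : ℕ) : (Fin (mW l) → ℤ) →+ (Fin (mW (l + 1)) → ℤ) :=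
  (Matrix.mulVecLin
    (fun (i : Fin (mW (l + 1))) (j : Fin (mW l)) => Imat l ((j : ℕ) + 1) ((i : ℕ) + 1))).toAddMonoidHom

/-- `ITreach a b x y` holds iff `y` is obtained from `x` by applying the maps
`I^t_{a,a+1}, I^t_{a+1,a+2}, …, I^t_{b-1,b}` successively (`y = x` if `b = a`). -/
inductive ITreach : ∀ (a b : ℕ), (Fin (mW a) → ℤ) → (Fin (mW b) → ℤ) → Prop
  | refl (a : ℕ) (x : Fin (mW a) → ℤ) : ITreach a a x x
  | step {a b : ℕ} {x : Fin (mW a) → ℤ} {y : Fin (mW b) → ℤ} :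
      ITreach a b x y → ITreach a (b + 1) x (ITadd b y)

/-- `g_k` computed at level `l`: `Σ_{j=1}^{k} |{i : 2 ≤ i ≤ m(l+1), I_{l,l+1}(j,i) = 1}|`. -/
def gAt (l k : ℕ) : ℕ :=
  ∑ j ∈ Finset.Icc 1 k, ((Finset.Icc 2 (mW (l + 1))).filter (fun i => Imat l j i = 1)).card

/-- The sequence `g_k` (computed at level `l = k`, for which `m(l) ≥ k`). -/
def gk (k : ℕ) : ℕ := gAt k k

/-- The subgroup `ℤ(l;k) = {x ∈ ℤ^{m(l)-1} : x_i = 0 for all i ≤ g_k}` (1-based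
coordinates; `ℤ(l;0) = ℤ^{m(l)-1}` since `g_0 = 0`). -/
def Zsub (l k : ℕ) : AddSubgroup (Fin (mW l - 1) → ℤ) where
  carrier := {x | ∀ i : Fin (mW l - 1), (i : ℕ) + 1 ≤ gk k → x i = 0}
  add_mem' := by
    intro a b ha hb i hi
    simp [Pi.add_apply, ha i hi, hb i hi]
  zero_mem' := by intro i hi; rfl
  neg_mem' := by
    intro a ha i hi
    simp [Pi.neg_apply, ha i hi]

/-- The Cantor space `𝒦 = {0,1}^ℕ`. -/
abbrev Kspace : Type := ℕ → Bool

theorem lexLt_iff (l : ℕ) (u w : Fin l → Fin 2) : lexLt l u w ↔ toLex u < toLex w := Iff.rfl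

theorem lexLt_irrefl (l : ℕ) (u : Fin l → Fin 2) : ¬lexLt l u u := fun h => lt_irrefl (toLex u) h

theorem rankW_lt_rankW {l : ℕ} {u w : Fin l → Fin 2} (hu : u ∈ Wset l) (h : lexLt l u w) :
    rankW l u < rankW l w := by
  unfold rankW
  refine Nat.add_lt_add_left (Finset.card_lt_card ?_) 1
  refine (Finset.ssubset_iff_of_subset ?_).2 ⟨u, by simp [hu, h], by simp [lexLt_irrefl]⟩
  intro v hv
  simp only [Finset.mem_filter, lexLt_iff] at hv h ⊢
  exact ⟨hv.1, hv.2.trans h⟩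

theorem rankW_injOn (l : ℕ) : Set.InjOn (rankW l) (Wset l) := by
  intro u hu w hw h
  rcases lt_trichotomy (toLex u) (toLex w) with h1 | h1 | h1
  · exact absurd h (rankW_lt_rankW hu h1).ne
  · exact h1
  · exact absurd h (rankW_lt_rankW hw h1).ne'

theorem rankW_le {l : ℕ} {w : Fin l → Fin 2} (hw : w ∈ Wset l) : rankW l w ≤ mW l := by
  have : ((Wset l).filter (fun u => lexLt l u w)).card < (Wset l).card :=
    Finset.card_lt_card (Finset.filter_ssubset.2 ⟨w, hw, lexLt_irrefl l w⟩)
  unfold rankW mW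
  omega

theorem exists_rankW_eq (l : ℕ) (i : Fin (mW l)) : ∃ w ∈ Wset l, rankW l w = (i : ℕ) + 1 := by
  have h := Finset.surj_on_of_inj_on_of_card_le (s := Wset l) (t := Finset.Icc 1 (mW l))
    (fun w _ => rankW l w)
    (fun w hw => Finset.mem_Icc.2 ⟨Nat.le_add_right _ _, rankW_le hw⟩)
    (fun u w hu hw e => rankW_injOn l hu hw e) (by simp [mW])
    ((i : ℕ) + 1) (Finset.mem_Icc.2 ⟨by omega, i.2⟩)
  obtain ⟨w, hw, e⟩ := h
  exact ⟨w, hw, e.symm⟩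

/-- The admissible word in position `i + 1` of the lexicographic ordering. -/
def word (l : ℕ) (i : Fin (mW l)) : Fin l → Fin 2 := (exists_rankW_eq l i).choose

theorem word_mem (l : ℕ) (i : Fin (mW l)) : word l i ∈ Wset l :=
  (exists_rankW_eq l i).choose_spec.1

theorem rankW_word (l : ℕ) (i : Fin (mW l)) : rankW l (word l i) = (i : ℕ) + 1 :=
  (exists_rankW_eq l i).choose_spec.2

theorem rankW_eq_iff {l : ℕ} {w : Fin l → Fin 2} (hw : w ∈ Wset l) (i : Fin (mW l)) :
    rankW l w = (i : ℕ) + 1 ↔ w = word l i := by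
  rw [← rankW_word l i]
  exact (rankW_injOn l).eq_iff hw (word_mem l i)

theorem word_injective (l : ℕ) : Function.Injective (word l) := by
  intro i j h
  have := rankW_word l i
  rw [h, rankW_word] at this
  exact Fin.ext (by omega)

theorem exists_word_eq {l : ℕ} {w : Fin l → Fin 2} (hw : w ∈ Wset l) : ∃ i, word l i = w := by
  have h := rankW_le hw
  have h1 : 1 ≤ rankW l w := Nat.le_add_right _ _
  refine ⟨⟨rankW l w - 1, by omega⟩, ((rankW_eq_iff hw _).1 ?_).symm⟩
  simp only
  omega

theorem sum_word {M : Type*} [AddCommMonoid M] (l : ℕ) (f : (Fin l → Fin 2) → M) :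
    ∑ i, f (word l i) = ∑ w ∈ Wset l, f w :=
  Finset.sum_bij (fun i _ => word l i) (fun i _ => word_mem l i)
    (fun _ _ _ _ h => word_injective l h)
    (fun _ hw => by simpa using exists_word_eq hw) (fun _ _ => rfl)

theorem Imat_word (l : ℕ) (j : Fin (mW l)) (i : Fin (mW (l + 1))) :
    Imat l ((j : ℕ) + 1) ((i : ℕ) + 1) =
      if word l j = Fin.init (word (l + 1) i) then 1 else 0 := by
  unfold Imat
  refine if_congr ⟨?_, ?_⟩ rfl rfl
  · rintro ⟨w, hw, w', hw', h1, h2, h3⟩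
    rw [rankW_eq_iff hw] at h1
    rw [rankW_eq_iff hw'] at h2
    subst h1 h2
    exact funext h3
  · intro h
    exact ⟨_, word_mem l j, _, word_mem _ i, rankW_word _ _, rankW_word _ _, fun k => by rw [h]; rfl⟩

theorem init_mem_Wset {l : ℕ} {w : Fin (l + 1) → Fin 2} (hw : w ∈ Wset (l + 1)) :
    Fin.init w ∈ Wset l := by
  simp only [Wset, Finset.mem_filter, Finset.mem_univ, true_and, DyckAdm] at hw ⊢
  exact fun i j h => hw i.castSucc j.castSucc (by simpa using h)

theorem tail_mem_Wset {l : ℕ} {w : Fin (l + 1) → Fin 2} (hw : w ∈ Wset (l + 1)) :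
    Fin.tail w ∈ Wset l := by
  simp only [Wset, Finset.mem_filter, Finset.mem_univ, true_and, DyckAdm] at hw ⊢
  exact fun i j h => hw i.succ j.succ (by simpa using h)

theorem ITadd_apply (l : ℕ) (f : (Fin l → Fin 2) → ℤ) (i : Fin (mW (l + 1))) :
    ITadd l (fun j => f (word l j)) i = f (Fin.init (word (l + 1) i)) := by
  have : ITadd l (fun j => f (word l j)) i =
      ∑ j : Fin (mW l), Imat l ((j : ℕ) + 1) ((i : ℕ) + 1) * f (word l j) := rfl
  rw [this]
  simp_rw [Imat_word]
  rw [sum_word l (fun w => (if w = Fin.init (word (l + 1) i) then (1 : ℤ) else 0) * f w)]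
  simp [init_mem_Wset (word_mem (l + 1) i)]

theorem Mmat_word (l : ℕ) (j : Fin (mW (l + 1))) (i : Fin (mW (l + 2))) :
    Mmat (l + 1) ((j : ℕ) + 1) ((i : ℕ) + 1) =
      (if word _ j = Fin.tail (word _ i) then 1 else 0) +
      (if ¬(word _ j 0 = 1 ∧ word _ i 0 = 1) ∧
        Fin.tail (word _ j) = Fin.init (Fin.init (word _ i)) then 1 else 0) := by
  rw [Mmat]
  rw [Finset.sum_eq_single_of_mem _ (word_mem (l + 1) j),
    Finset.sum_eq_single_of_mem _ (word_mem (l + 2) i)]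
  · rw [if_pos ⟨rankW_word _ _, rankW_word _ _⟩]
    congr 1
    · refine if_congr ?_ rfl rfl
      exact ⟨fun h => (funext h).symm, fun h t => by rw [h]; rfl⟩
    · refine if_congr (and_congr Iff.rfl ⟨fun h => funext fun t => h t.succ (by simp), ?_⟩) rfl rfl
      intro h t
      refine Fin.cases (fun h => absurd rfl h) (fun t _ => congrFun h t) t
  · intro w' hw' hne
    rw [if_neg]
    rw [rankW_eq_iff hw']
    exact fun h => hne h.2
  · intro w hw hne
    refine Finset.sum_eq_zero fun w' _ => if_neg ?_
    rw [rankW_eq_iff hw]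
    exact fun h => hne h.1

theorem cons_init_mem_Wset {l : ℕ} {w : Fin (l + 2) → Fin 2} (hw : w ∈ Wset (l + 2)) {a : Fin 2}
    (ha : ¬(a = 1 ∧ w 0 = 1)) :
    (Fin.cons a (Fin.init (Fin.init w)) : Fin (l + 1) → Fin 2) ∈ Wset (l + 1) := by
  have hw := init_mem_Wset (init_mem_Wset hw)
  simp only [Wset, Finset.mem_filter, Finset.mem_univ, true_and, DyckAdm] at hw ⊢
  intro i j
  induction j using Fin.cases with
  | zero => simp
  | succ j =>
    induction i using Fin.cases with
    | zero =>
      intro h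
      have : j.castSucc.castSucc = 0 := by
        ext
        simpa using h
      simpa [Fin.init, this] using ha
    | succ i =>
      intro h
      simpa using hw i j (by simpa using h)

theorem Aadd_apply (l : ℕ) (f : (Fin (l + 1) → Fin 2) → ℤ) (i : Fin (mW (l + 2))) :
    Aadd (l + 1) (fun j => f (word (l + 1) j)) i =
      f (Fin.tail (word _ i)) +
      (f (Fin.cons 0 (Fin.init (Fin.init (word _ i)))) +
        if word _ i 0 = 0 then f (Fin.cons 1 (Fin.init (Fin.init (word _ i)))) else 0) -
      f (Fin.init (word _ i)) := by
  have h0 : Aadd (l + 1) (fun j => f (word (l + 1) j)) i =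
      ∑ j : Fin (mW (l + 1)),
        (Mmat (l + 1) ((j : ℕ) + 1) ((i : ℕ) + 1) - Imat (l + 1) ((j : ℕ) + 1) ((i : ℕ) + 1)) *
          f (word (l + 1) j) := rfl
  rw [h0]
  simp_rw [Mmat_word, Imat_word]
  have hi := word_mem (l + 2) i
  generalize word (l + 2) i = w' at hi ⊢
  rw [sum_word (l + 1) (fun w => ((if w = Fin.tail w' then (1 : ℤ) else 0) +
      (if ¬(w 0 = 1 ∧ w' 0 = 1) ∧ Fin.tail w = Fin.init (Fin.init w') then 1 else 0) -
      (if w = Fin.init w' then 1 else 0)) * f w)]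
  simp only [sub_mul, add_mul, Finset.sum_sub_distrib, Finset.sum_add_distrib, ite_mul, one_mul,
    zero_mul, Finset.sum_ite_eq', init_mem_Wset hi, tail_mem_Wset hi, if_true]
  congr 2
  have hS : ∀ w ∈ Wset (l + 1),
      (if ¬(w 0 = 1 ∧ w' 0 = 1) ∧ Fin.tail w = Fin.init (Fin.init w') then f w else 0) =
      ∑ a : Fin 2, if w = (Fin.cons a (Fin.init (Fin.init w')) : Fin (l + 1) → Fin 2) then
        (if ¬(a = 1 ∧ w' 0 = 1) then f w else 0) else 0 := by
    intro w _
    rw [Finset.sum_eq_single (w 0)]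
    · by_cases h : Fin.tail w = Fin.init (Fin.init w')
      · rw [← h, Fin.cons_self_tail]
        simp
      · rw [if_neg (fun h1 => h h1.2), if_neg]
        intro h1
        rw [h1] at h
        exact h (Fin.tail_cons _ _)
    · intro a _ ha
      rw [if_neg]
      rintro rfl
      simp at ha
    · simp
  rw [Finset.sum_congr rfl hS, Finset.sum_comm]
  simp only [Finset.sum_ite_eq', Fin.sum_univ_two]
  have h0 := cons_init_mem_Wset hi (a := 0) (by simp)
  rw [if_pos h0]
  congr 1
  by_cases h : w' 0 = 1
  · simp [h]
  · have h' : w' 0 = 0 := by omega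
    rw [if_pos (cons_init_mem_Wset hi (by simp [h]))]
    simp [h']

/-- Admissibility for words written as lists. -/
abbrev AdmList (L : List (Fin 2)) : Prop := L.IsChain fun a b => ¬(a = 1 ∧ b = 1)

theorem mem_Wset_iff {l : ℕ} {w : Fin l → Fin 2} : w ∈ Wset l ↔ AdmList (List.ofFn w) := by
  simp only [Wset, Finset.mem_filter, Finset.mem_univ, true_and, DyckAdm, AdmList,
    List.isChain_iff_getElem, List.length_ofFn, List.getElem_ofFn]
  constructor
  · exact fun h i hi => h _ _ rfl
  · rintro h ⟨i, hi⟩ ⟨j, hj⟩ rfl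
    exact h i hj

/-- The admissible word in position `i + 1`, as a list. -/
def wordList (l : ℕ) (i : Fin (mW l)) : List (Fin 2) := List.ofFn (word l i)

@[simp] theorem length_wordList (l : ℕ) (i : Fin (mW l)) : (wordList l i).length = l := by
  simp [wordList]

theorem admList_wordList (l : ℕ) (i : Fin (mW l)) : AdmList (wordList l i) :=
  mem_Wset_iff.1 (word_mem l i)

theorem wordList_injective (l : ℕ) : Function.Injective (wordList l) :=
  fun _ _ h => word_injective l (List.ofFn_injective h)

theorem exists_wordList_eq {L : List (Fin 2)} (hL : AdmList L) :
    ∃ i, wordList L.length i = L := by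
  have h : (fun i : Fin L.length => L[i]) ∈ Wset L.length := by
    rw [mem_Wset_iff]
    simpa using hL
  obtain ⟨i, hi⟩ := exists_word_eq h
  exact ⟨i, by simp [wordList, hi]⟩

theorem ofFn_init {l : ℕ} (w : Fin (l + 1) → Fin 2) :
    List.ofFn (Fin.init w) = (List.ofFn w).dropLast := by
  rw [List.ofFn_succ' w]
  simp
  rfl

theorem ofFn_tail {l : ℕ} (w : Fin (l + 1) → Fin 2) :
    List.ofFn (Fin.tail w) = (List.ofFn w).tail := by
  rw [List.ofFn_succ]
  rfl

/-- The indicator function of the set of admissible words of length `l` with prefix `L`. -/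
def cyl (l : ℕ) (L : List (Fin 2)) : Fin (mW l) → ℤ := fun i => if L <+: wordList l i then 1 else 0

theorem cyl_eq_zero {L : List (Fin 2)} (hL : ¬AdmList L) (l : ℕ) : cyl l L = 0 := by
  funext i
  refine if_neg fun h => hL ?_
  exact (admList_wordList l i).prefix h

theorem cyl_wordList (l : ℕ) (i : Fin (mW l)) : cyl l (wordList l i) = Pi.single i 1 := by
  funext j
  rw [cyl, Pi.single_apply]
  refine if_congr ⟨fun h => ?_, ?_⟩ rfl rfl
  · exact wordList_injective l (h.eq_of_length (by simp)).symm
  · rintro rfl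
    exact List.prefix_rfl

theorem prefix_indicator_split {L M : List (Fin 2)} (h : L.length < M.length) :
    (if L <+: M then (1 : ℤ) else 0) =
      (if L ++ [0] <+: M then 1 else 0) + if L ++ [1] <+: M then 1 else 0 := by
  induction L generalizing M with
  | nil =>
    obtain ⟨b, M, rfl⟩ := List.exists_cons_of_length_pos h
    fin_cases b <;> simp [List.cons_prefix_cons]
  | cons a L ih =>
    obtain ⟨b, M, rfl⟩ := List.exists_cons_of_length_pos (by omega : 0 < M.length)
    by_cases hab : a = b
    · subst hab
      simpa [List.cons_prefix_cons] using ih (M := M) (by simpa using h)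
    · simp [List.cons_prefix_cons, hab]

theorem cyl_split {l : ℕ} {L : List (Fin 2)} (h : L.length < l) :
    cyl l L = cyl l (L ++ [0]) + cyl l (L ++ [1]) := by
  funext i
  exact prefix_indicator_split (by simpa using h)

theorem prefix_dropLast_iff {L M : List (Fin 2)} (h : L.length + 1 ≤ M.length) :
    L <+: M.dropLast ↔ L <+: M := by
  refine ⟨fun h' => h'.trans (List.dropLast_prefix M), fun h' => ?_⟩
  rw [List.dropLast_eq_take]
  exact List.prefix_take_iff.2 ⟨h', by omega⟩

theorem ITadd_cyl {l : ℕ} {L : List (Fin 2)} (h : L.length ≤ l) :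
    ITadd l (cyl l L) = cyl (l + 1) L := by
  funext i
  refine (ITadd_apply l (fun w => if L <+: List.ofFn w then 1 else 0) i).trans ?_
  rw [ofFn_init]
  exact if_congr (prefix_dropLast_iff (by simpa using h)) rfl rfl

theorem Aadd_cyl_apply {l : ℕ} {a : Fin 2} {L : List (Fin 2)} (h : L.length ≤ l)
    (i : Fin (mW (l + 2))) :
    Aadd (l + 1) (cyl (l + 1) (a :: L)) i =
      cyl (l + 2) (0 :: a :: L) i + cyl (l + 2) (1 :: a :: L) i +
        (if a = 1 ∧ word (l + 2) i 0 = 1 then 0 else cyl (l + 2) L i) - cyl (l + 2) (a :: L) i := by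
  refine (Aadd_apply l (fun w => if a :: L <+: List.ofFn w then 1 else 0) i).trans ?_
  have h1 : ∀ b, (a :: L <+: List.ofFn (Fin.cons b (Fin.init (Fin.init (word (l + 2) i))) :
      Fin (l + 1) → Fin 2)) ↔ a = b ∧ L <+: wordList (l + 2) i := by
    intro b
    rw [List.ofFn_cons, List.cons_prefix_cons, ofFn_init, ofFn_init,
      prefix_dropLast_iff (by simpa using h), prefix_dropLast_iff (by simp; omega)]
    rfl
  have h2 : (if a :: L <+: List.ofFn (Fin.tail (word (l + 2) i)) then (1 : ℤ) else 0) =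
      cyl (l + 2) (0 :: a :: L) i + cyl (l + 2) (1 :: a :: L) i := by
    rw [ofFn_tail]
    unfold cyl wordList
    obtain ⟨b, M, hM⟩ := List.exists_cons_of_length_pos
      (by simp : 0 < (List.ofFn (word (l + 2) i)).length)
    rw [hM]
    fin_cases b <;> simp [List.cons_prefix_cons] <;> congr
  have h3 : (a :: L <+: List.ofFn (Fin.init (word (l + 2) i))) ↔ a :: L <+: wordList (l + 2) i := by
    rw [ofFn_init]
    exact prefix_dropLast_iff (by simpa using h)
  simp only [h1, h2, h3]
  congr 2
  generalize word (l + 2) i 0 = c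
  unfold cyl
  fin_cases a <;> fin_cases c <;> simp

theorem Aadd_cyl_zero_cons {l : ℕ} {L : List (Fin 2)} (h : L.length ≤ l) :
    Aadd (l + 1) (cyl (l + 1) (0 :: L)) =
      cyl (l + 2) (0 :: 0 :: L) + cyl (l + 2) (1 :: 0 :: L) + cyl (l + 2) L -
        cyl (l + 2) (0 :: L) := by
  funext i
  rw [Aadd_cyl_apply h]
  simp

theorem Aadd_cyl_one (l : ℕ) :
    Aadd (l + 1) (cyl (l + 1) [1]) = cyl (l + 2) [0, 1] + cyl (l + 2) [0] - cyl (l + 2) [1] := by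
  funext i
  rw [Aadd_cyl_apply (Nat.zero_le l), cyl_eq_zero (L := [1, 1]) (by simp)]
  have : (if (1 : Fin 2) = 1 ∧ word (l + 2) i 0 = 1 then 0 else cyl (l + 2) [] i) =
      cyl (l + 2) [0] i := by
    unfold cyl
    rw [wordList, List.ofFn_succ]
    generalize word (l + 2) i 0 = c
    fin_cases c <;> simp [List.cons_prefix_cons]
  rw [this]
  simp

theorem Aadd_cyl_one_zero_cons {l : ℕ} {L : List (Fin 2)} (h : L.length + 1 ≤ l) :
    Aadd (l + 1) (cyl (l + 1) (1 :: 0 :: L)) =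
      cyl (l + 2) (0 :: 1 :: 0 :: L) + cyl (l + 2) (0 :: L) - cyl (l + 2) (1 :: 0 :: L) := by
  funext i
  rw [Aadd_cyl_apply (by simpa using h), cyl_eq_zero (L := 1 :: 1 :: 0 :: L) (by simp)]
  have : (if (1 : Fin 2) = 1 ∧ word (l + 2) i 0 = 1 then 0 else cyl (l + 2) (0 :: L) i) =
      cyl (l + 2) (0 :: L) i := by
    unfold cyl
    rw [wordList, List.ofFn_succ]
    generalize word (l + 2) i 0 = c
    fin_cases c <;> simp [List.cons_prefix_cons]
  rw [this]
  simp

/-- A function on finite words that behaves like the classes of cylinder indicators in the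
cokernel of `f ↦ f ∘ σ + ∑ₐ f (a ·) - f`. -/
structure IsCylinderSystem {H : Type*} [AddCommGroup H] (t : List (Fin 2) → H) : Prop where
  eq_zero : ∀ L, ¬AdmList L → t L = 0
  split : ∀ L, t L = t (L ++ [0]) + t (L ++ [1])
  rel_zero : ∀ L, t (0 :: 0 :: L) + t (1 :: 0 :: L) + t L - t (0 :: L) = 0
  rel_one : t [0, 1] + t [0] - t [1] = 0
  rel_one_zero : ∀ L, t (0 :: 1 :: 0 :: L) + t (0 :: L) - t (1 :: 0 :: L) = 0

section evaluation

variable {H : Type*} [AddCommGroup H] {t : List (Fin 2) → H}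

/-- The homomorphism `ℤ^{m(l)} → H` sending the indicator of a word `w` to `t w`. -/
def evalWords (t : List (Fin 2) → H) (l : ℕ) : (Fin (mW l) → ℤ) →ₗ[ℤ] H :=
  Fintype.linearCombination ℤ fun i => t (wordList l i)

theorem linearMap_eq_of_cyl {l : ℕ} {f g : (Fin (mW l) → ℤ) →ₗ[ℤ] H}
    (h : ∀ L : List (Fin 2), L.length = l → f (cyl l L) = g (cyl l L)) : f = g := by
  refine (Pi.basisFun ℤ (Fin (mW l))).ext fun i => ?_
  rw [Pi.basisFun_apply, ← cyl_wordList]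
  exact h _ (length_wordList l i)

theorem evalWords_cyl (ht : IsCylinderSystem t) {l : ℕ} {L : List (Fin 2)} (hL : L.length ≤ l) :
    evalWords t l (cyl l L) = t L := by
  obtain ⟨k, hk⟩ := Nat.exists_eq_add_of_le hL
  induction k generalizing L with
  | zero =>
    obtain rfl : l = L.length := hk
    by_cases h : AdmList L
    · obtain ⟨i, hi⟩ := exists_wordList_eq h
      have h2 : cyl L.length L = Pi.single i 1 := by rw [← cyl_wordList, hi]
      rw [h2, evalWords, Fintype.linearCombination_apply_single, hi, one_smul]
    · rw [cyl_eq_zero h, ht.eq_zero L h, map_zero]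
  | succ k ih =>
    rw [cyl_split (by omega), map_add, ih (by simp; omega) (by simp; omega),
      ih (by simp; omega) (by simp; omega), ht.split L]

theorem evalWords_ITadd (ht : IsCylinderSystem t) (l : ℕ) (x : Fin (mW l) → ℤ) :
    evalWords t (l + 1) (ITadd l x) = evalWords t l x := by
  have : evalWords t (l + 1) ∘ₗ (ITadd l).toIntLinearMap = evalWords t l := by
    refine linearMap_eq_of_cyl fun L hL => ?_
    simp only [LinearMap.comp_apply, AddMonoidHom.coe_toIntLinearMap]
    rw [ITadd_cyl hL.le, evalWords_cyl ht (by omega), evalWords_cyl ht hL.le]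
  exact LinearMap.congr_fun this x

theorem evalWords_Aadd (ht : IsCylinderSystem t) (l : ℕ) (x : Fin (mW (l + 1)) → ℤ) :
    evalWords t (l + 2) (Aadd (l + 1) x) = 0 := by
  have : evalWords t (l + 2) ∘ₗ (Aadd (l + 1)).toIntLinearMap = 0 := by
    refine linearMap_eq_of_cyl fun L hL => ?_
    simp only [LinearMap.comp_apply, AddMonoidHom.coe_toIntLinearMap, LinearMap.zero_apply]
    match L, hL with
    | 0 :: L, hL =>
      simp only [List.length_cons] at hL
      rw [Aadd_cyl_zero_cons (by omega), map_sub, map_add, map_add, evalWords_cyl ht (by simp; omega),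
        evalWords_cyl ht (by simp; omega), evalWords_cyl ht (by omega),
        evalWords_cyl ht (by simp; omega), ht.rel_zero]
    | [1], hL =>
      rw [Aadd_cyl_one, map_sub, map_add, evalWords_cyl ht (by simp), evalWords_cyl ht (by simp),
        evalWords_cyl ht (by simp), ht.rel_one]
    | 1 :: 0 :: L, hL =>
      simp only [List.length_cons] at hL
      rw [Aadd_cyl_one_zero_cons (by omega), map_sub, map_add,
        evalWords_cyl ht (by simp; omega), evalWords_cyl ht (by simp; omega),
        evalWords_cyl ht (by simp; omega), ht.rel_one_zero]
    | 1 :: 1 :: L, hL => rw [cyl_eq_zero (by simp), map_zero, map_zero]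
  exact LinearMap.congr_fun this x

theorem evalWords_eq_of_ITreach (ht : IsCylinderSystem t) {a b : ℕ} {x : Fin (mW a) → ℤ}
    {y : Fin (mW b) → ℤ} (h : ITreach a b x y) : evalWords t b y = evalWords t a x := by
  induction h with
  | refl => rfl
  | step _ ih => rw [evalWords_ITadd ht, ih]

end evaluation

/-- Admissible words of length at least two whose first and last letters are coded by `1`; together
with the empty word they index a basis of the limit group. -/
def IsBasic (L : List (Fin 2)) : Prop := AdmList L ∧ ∃ M, L = 1 :: (M ++ [1])

/-- The index set of the basis: `none` stands for the empty word. -/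
abbrev BasisIndex : Type := Option {L : List (Fin 2) // IsBasic L}

/-- The word of an index. -/
def BasisIndex.toList : BasisIndex → List (Fin 2)
  | none => []
  | some L => L.1

open Classical in
/-- The normal form of the class of the cylinder of `L ++ [1]`, for `L` empty or with first
letter `1`. -/
def nfEndOne (L : List (Fin 2)) : BasisIndex →₀ ℤ :=
  if L = [] then Finsupp.single none 2
  else if h : IsBasic (L ++ [1]) then Finsupp.single (some ⟨_, h⟩) 1 else 0

/-- The normal form of a word with first letter `1`, given reversed. -/
def nfReverse : List (Fin 2) → BasisIndex →₀ ℤ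
  | [] => 0
  | a :: r => if a = 1 then nfEndOne r.reverse else nfReverse r - nfEndOne r.reverse

/-- The normal form of the class of the cylinder of a word. -/
def nf : List (Fin 2) → BasisIndex →₀ ℤ
  | [] => Finsupp.single none 1
  | [0] => -Finsupp.single none 1
  | 1 :: L => nfReverse (1 :: L).reverse
  | 0 :: 0 :: L => nf (0 :: L) - nf L - nfReverse (1 :: 0 :: L).reverse
  | [0, 1] => Finsupp.single none 3
  | 0 :: 1 :: 0 :: L => nfReverse (1 :: 0 :: L).reverse - nf (0 :: L)
  | 0 :: 1 :: 1 :: _ => 0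

theorem nfReverse_reverse_append (L : List (Fin 2)) :
    nfReverse L.reverse = nfReverse (L ++ [0]).reverse + nfReverse (L ++ [1]).reverse := by
  simp [nfReverse]

theorem nfReverse_eq_zero {r : List (Fin 2)} (h : ¬AdmList r.reverse) : nfReverse r = 0 := by
  induction r with
  | nil => rfl
  | cons a r ih =>
    rw [List.reverse_cons] at h
    have hr : r.reverse ≠ [] := by
      rintro e
      simp [e] at h
    have h1 : nfEndOne r.reverse = 0 ∧ (a ≠ 1 → nfReverse r = 0) := by
      by_cases hadm : AdmList r.reverse
      · have ha : a = 1 := by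
          by_contra ha
          refine h (List.isChain_append.2 ⟨hadm, by simp, ?_⟩)
          simp [ha]
        subst ha
        refine ⟨?_, by simp⟩
        rw [nfEndOne, if_neg hr, dif_neg fun hb => h hb.1]
      · refine ⟨?_, fun _ => ih hadm⟩
        rw [nfEndOne, if_neg hr, dif_neg fun hb => hadm (List.IsChain.left_of_append hb.1)]
    rw [nfReverse, h1.1]
    split_ifs with ha
    · rfl
    · rw [h1.2 ha, sub_zero]

theorem nf_one_cons (L : List (Fin 2)) : nf (1 :: L) = nfReverse (1 :: L).reverse := by
  rw [nf]

theorem nf_one_one (L : List (Fin 2)) : nf (1 :: 1 :: L) = 0 := by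
  rw [nf_one_cons]
  exact nfReverse_eq_zero (by simp)

theorem nf_one : nf [1] = Finsupp.single none 2 := by
  simp [nf, nfReverse, nfEndOne]

theorem nf_one_split (L : List (Fin 2)) :
    nf (1 :: L) = nf (1 :: L ++ [0]) + nf (1 :: L ++ [1]) := by
  simp only [List.cons_append, nf_one_cons]
  exact nfReverse_reverse_append (1 :: L)

theorem nf_one_zero : nf [1, 0] = Finsupp.single none 2 := by
  rw [← nf_one, nf_one_split [], List.singleton_append, List.singleton_append, nf_one_one, add_zero]

theorem nf_zero_zero (L : List (Fin 2)) :
    nf (0 :: 0 :: L) = nf (0 :: L) - nf L - nf (1 :: 0 :: L) := by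
  rw [nf_one_cons, nf]

theorem nf_zero_one_zero (L : List (Fin 2)) :
    nf (0 :: 1 :: 0 :: L) = nf (1 :: 0 :: L) - nf (0 :: L) := by
  rw [nf_one_cons, nf]

theorem nf_split : ∀ L : List (Fin 2), nf L = nf (L ++ [0]) + nf (L ++ [1])
  | [] => by
    simp only [List.nil_append, nf_one, nf, ← Finsupp.single_neg, ← Finsupp.single_add]
    norm_num
  | [0] => by
    simp only [List.cons_append, List.nil_append, nf_zero_zero, nf_one_zero]
    simp only [nf, ← Finsupp.single_neg, ← Finsupp.single_add, ← Finsupp.single_sub]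
    norm_num
  | 1 :: L => nf_one_split L
  | 0 :: 0 :: L => by
    have h1 := nf_split (0 :: L)
    have h2 := nf_split L
    have h3 := nf_one_split (0 :: L)
    simp only [List.cons_append, nf_zero_zero] at h1 h3 ⊢
    rw [h1, h2, h3]
    abel
  | [0, 1] => by
    simp only [List.cons_append, List.nil_append, nf_zero_one_zero, nf_one_zero]
    simp only [nf, ← Finsupp.single_neg, ← Finsupp.single_sub, add_zero]
    norm_num
  | 0 :: 1 :: 0 :: L => by
    have h1 := nf_split (0 :: L)
    have h3 := nf_one_split (0 :: L)
    simp only [List.cons_append, nf_zero_one_zero] at h1 h3 ⊢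
    rw [h1, h3]
    abel
  | 0 :: 1 :: 1 :: L => by simp [nf]

theorem nf_eq_zero : ∀ L : List (Fin 2), ¬AdmList L → nf L = 0
  | [], h => absurd (by simp) h
  | [0], h => absurd (by simp) h
  | 1 :: L, h => by
    rw [nf_one_cons]
    exact nfReverse_eq_zero (by rwa [List.reverse_reverse])
  | 0 :: 0 :: L, h => by
    have h1 : ¬AdmList (0 :: L) := fun h' => h (List.isChain_cons_cons.2 ⟨by simp, h'⟩)
    have h2 : ¬AdmList L := fun h' => h1 (List.isChain_cons.2 ⟨by simp, h'⟩)
    have h3 : ¬AdmList (1 :: 0 :: L) := fun h' => h1 (List.isChain_cons_cons.1 h').2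
    rw [nf_zero_zero, nf_eq_zero _ h1, nf_eq_zero _ h2, nf_one_cons,
      nfReverse_eq_zero (by rwa [List.reverse_reverse])]
    simp
  | [0, 1], h => absurd (by simp) h
  | 0 :: 1 :: 0 :: L, h => by
    have h3 : ¬AdmList (1 :: 0 :: L) := fun h' => h (List.isChain_cons_cons.2 ⟨by simp, h'⟩)
    have h1 : ¬AdmList (0 :: L) := fun h' => h3 (List.isChain_cons_cons.2 ⟨by simp, h'⟩)
    rw [nf_zero_one_zero, nf_eq_zero _ h1, nf_one_cons,
      nfReverse_eq_zero (by rwa [List.reverse_reverse])]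
    simp
  | 0 :: 1 :: 1 :: L, h => by simp [nf]

theorem isCylinderSystem_nf : IsCylinderSystem nf where
  eq_zero := nf_eq_zero
  split := nf_split
  rel_zero L := by
    rw [nf_zero_zero]
    abel
  rel_one := by
    rw [nf_one]
    simp only [nf, ← Finsupp.single_neg, ← Finsupp.single_add, ← Finsupp.single_sub]
    norm_num
  rel_one_zero L := by
    rw [nf_zero_one_zero]
    abel

theorem nf_toList (i : BasisIndex) : nf i.toList = Finsupp.single i 1 := by
  match i with
  | none => rw [BasisIndex.toList, nf]
  | some ⟨L, hL⟩ =>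
    obtain ⟨M, rfl⟩ := hL.2
    have h : IsBasic ((1 :: M) ++ [1]) := hL
    rw [BasisIndex.toList, nf_one_cons]
    have : (1 :: (M ++ [1])).reverse = 1 :: (1 :: M).reverse := by simp
    rw [this, nfReverse, if_pos rfl, List.reverse_reverse, nfEndOne, if_neg (by simp), dif_pos h]
    rfl

section universal

variable {H : Type*} [AddCommGroup H] {t : List (Fin 2) → H}

/-- The homomorphism from the free group on the basis indices determined by `t`. -/
def fromNf (t : List (Fin 2) → H) : (BasisIndex →₀ ℤ) →ₗ[ℤ] H :=
  Finsupp.linearCombination ℤ fun i => t i.toList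

theorem fromNf_single (t : List (Fin 2) → H) (i : BasisIndex) (c : ℤ) :
    fromNf t (Finsupp.single i c) = c • t i.toList := by
  simp [fromNf]

theorem IsCylinderSystem.one_zero (ht : IsCylinderSystem t) : t [1, 0] = t [1] := by
  have h := ht.split [1]
  rw [List.singleton_append, List.singleton_append, ht.eq_zero [1, 1] (by simp), add_zero] at h
  exact h.symm

theorem IsCylinderSystem.zero_eq (ht : IsCylinderSystem t) : t [0] = -t [] := by
  have h1 := ht.rel_zero []
  have h2 := ht.rel_one
  have h3 := ht.split [0]
  rw [List.singleton_append, List.singleton_append] at h3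
  rw [ht.one_zero] at h1
  have : t [0] + t [] = (t [0, 0] + t [1] + t [] - t [0]) + (t [0, 1] + t [0] - t [1]) +
      (t [0] - (t [0, 0] + t [0, 1])) := by abel
  rw [h1, h2, ← h3, sub_self] at this
  exact eq_neg_of_add_eq_zero_left (by simpa using this)

theorem IsCylinderSystem.one_eq (ht : IsCylinderSystem t) : t [1] = (2 : ℤ) • t [] := by
  have h := ht.split []
  rw [List.nil_append, List.nil_append, ht.zero_eq] at h
  rw [two_smul]
  nth_rewrite 1 [h]
  abel

theorem fromNf_nfEndOne (ht : IsCylinderSystem t) {L : List (Fin 2)}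
    (hL : L = [] ∨ ∃ M, L = 1 :: M) : fromNf t (nfEndOne L) = t (L ++ [1]) := by
  rw [nfEndOne]
  rcases hL with rfl | ⟨M, rfl⟩
  · simp [fromNf_single, ht.one_eq, BasisIndex.toList]
  · rw [if_neg (by simp)]
    by_cases hb : IsBasic (1 :: M ++ [1])
    · rw [dif_pos hb, fromNf_single, one_smul]
      rfl
    · rw [dif_neg hb, map_zero]
      exact (ht.eq_zero _ fun ha => hb ⟨ha, M, rfl⟩).symm

theorem fromNf_nfReverse (ht : IsCylinderSystem t) (r : List (Fin 2)) :
    ∀ L, r.reverse = 1 :: L → fromNf t (nfReverse r) = t (1 :: L) := by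
  induction r with
  | nil => simp
  | cons a r ih =>
    intro L h
    rw [← h, List.reverse_cons]
    rw [List.reverse_cons] at h
    have hr : r.reverse = [] ∨ ∃ M, r.reverse = 1 :: M := by
      rcases hr : r.reverse with _ | ⟨b, M⟩
      · exact Or.inl rfl
      · rw [hr, List.cons_append, List.cons.injEq] at h
        exact Or.inr ⟨M, by rw [h.1]⟩
    rw [nfReverse]
    split_ifs with ha
    · rw [fromNf_nfEndOne ht hr, ha]
    · obtain rfl : a = 0 := by omega
      rw [map_sub, fromNf_nfEndOne ht hr]
      rcases hr with hr | ⟨M, hr⟩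
      · simp [hr] at h
      · rw [ih M hr, ← hr, ht.split r.reverse]
        abel

theorem fromNf_nf (ht : IsCylinderSystem t) : ∀ L, fromNf t (nf L) = t L
  | [] => by simp [nf, fromNf_single, BasisIndex.toList]
  | [0] => by simp [nf, fromNf_single, BasisIndex.toList, ht.zero_eq]
  | 1 :: L => by
    rw [nf_one_cons]
    exact fromNf_nfReverse ht _ L (List.reverse_reverse _)
  | 0 :: 0 :: L => by
    rw [nf_zero_zero, map_sub, map_sub, fromNf_nf ht (0 :: L), fromNf_nf ht L, nf_one_cons,
      fromNf_nfReverse ht _ (0 :: L) (List.reverse_reverse _), ← sub_eq_zero.1 (ht.rel_zero L)]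
    abel
  | [0, 1] => by
    have h := ht.rel_one
    rw [ht.zero_eq, ht.one_eq] at h
    rw [sub_eq_zero, ← sub_eq_add_neg, sub_eq_iff_eq_add] at h
    rw [nf, fromNf_single, BasisIndex.toList, h]
    abel
  | 0 :: 1 :: 0 :: L => by
    rw [nf_zero_one_zero, map_sub, fromNf_nf ht (0 :: L), nf_one_cons,
      fromNf_nfReverse ht _ (0 :: L) (List.reverse_reverse _), ← sub_eq_zero.1 (ht.rel_one_zero L)]
    abel
  | 0 :: 1 :: 1 :: L => by
    rw [nf, map_zero, ht.eq_zero _ (by simp)]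

end universal

/-! ### Countable free groups -/

instance : Infinite BasisIndex := by
  have h : ∀ k : ℕ, IsBasic (1 :: (List.replicate (k + 1) 0 ++ [1])) := by
    refine fun k => ⟨?_, _, rfl⟩
    refine List.isChain_cons.2 ⟨by simp [List.replicate_succ], ?_⟩
    refine List.isChain_append.2 ⟨?_, by simp, ?_⟩
    · exact List.isChain_replicate_of_rel _ (by simp)
    · simp [List.getLast?_replicate]
  refine Infinite.of_injective (fun k : ℕ => (some ⟨_, h k⟩ : BasisIndex)) fun a b hab => ?_
  have := congrArg (fun i : BasisIndex => i.toList.length) hab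
  simpa [BasisIndex.toList] using this

instance : Countable C(Kspace, ℤ) := by
  have : DiscreteTopology C(Kspace, ℤ) := by
    refine DiscreteTopology.of_forall_le_dist one_pos fun f g hfg => ?_
    obtain ⟨x, hx⟩ := DFunLike.ne_iff.1 hfg
    exact (Int.pairwise_one_le_dist hx).trans (ContinuousMap.dist_apply_le_dist x)
  exact TopologicalSpace.separableSpace_iff_countable.1 inferInstance

theorem free_continuousMap : Module.Free ℤ C(Kspace, ℤ) := by
  have e : LocallyConstant Kspace ℤ ≃ₗ[ℤ] C(Kspace, ℤ) :=
    LinearEquiv.ofBijective (LocallyConstant.toContinuousMapLinearMap ℤ)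
      ⟨LocallyConstant.toContinuousMap_injective, fun f =>
        ⟨⟨f, (IsLocallyConstant.iff_continuous f).2 f.continuous⟩, rfl⟩⟩
  have : Module.Free ℤ (LocallyConstant Kspace ℤ) :=
    LocallyConstant.freeOfProfinite (Profinite.of Kspace)
  exact Module.Free.of_equiv e

theorem nonempty_basisIndex_equiv :
    Nonempty ((BasisIndex →₀ ℤ) ≃+ (ℤ × DirectSum ℕ (fun _ => ContinuousMap Kspace ℤ))) := by
  have := free_continuousMap
  let b := Module.Free.chooseBasis ℤ C(Kspace, ℤ)
  have hne : Nonempty (Module.Free.ChooseBasisIndex ℤ C(Kspace, ℤ)) := b.index_nonempty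
  have hc : Countable (Module.Free.ChooseBasisIndex ℤ C(Kspace, ℤ)) := b.injective.countable
  let B : Module.Basis (Unit ⊕ Σ _ : ℕ, Module.Free.ChooseBasisIndex ℤ C(Kspace, ℤ)) ℤ
      (ℤ × DirectSum ℕ (fun _ => C(Kspace, ℤ))) :=
    (Module.Basis.singleton Unit ℤ).prod (DFinsupp.basis fun _ => b)
  obtain ⟨e⟩ := nonempty_equiv_of_countable (α := BasisIndex)
    (β := Unit ⊕ Σ _ : ℕ, Module.Free.ChooseBasisIndex ℤ C(Kspace, ℤ))
  exact ⟨((Finsupp.domLCongr e).trans B.repr.symm).toAddEquiv⟩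

/-- the inductive limit of the system
`{ℤ^{m(l+1)}/(M_{l,l+1}^t − I_{l,l+1}^t)ℤ^{m(l)}}_{l ≥ 1}` (here `l = n + 1`), with
connecting maps induced by `I_{l+1,l+2}^t`, is isomorphic to `ℤ ⊕ (⊕_{n ∈ ℕ} C(𝒦,ℤ))`:
whenever a family `θ` presents a group `T` as that inductive limit (compatible, jointly
surjective, with only eventually-vanishing classes in the kernels), one has
`T ≅ ℤ ⊕ (⊕_{n ∈ ℕ} C(𝒦,ℤ))`.  (This limit is `K_0` of the matrix system `(M,I)`,
hence `K_0(O_{𝔏^{Ch(D_F)}})`.) -/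
theorem K0_limit_iso :
    ∀ (T : Type) [AddCommGroup T]
      (θ : ∀ n : ℕ, ((Fin (mW (n + 2)) → ℤ) ⧸ (Aadd (n + 1)).range) →+ T),
      (∀ (n : ℕ) (x : Fin (mW (n + 2)) → ℤ),
          θ (n + 1) (QuotientAddGroup.mk' (Aadd (n + 2)).range (ITadd (n + 2) x)) =
            θ n (QuotientAddGroup.mk' (Aadd (n + 1)).range x)) →
      (∀ t : T, ∃ (n : ℕ) (x : Fin (mW (n + 2)) → ℤ),
          θ n (QuotientAddGroup.mk' (Aadd (n + 1)).range x) = t) →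
      (∀ (n : ℕ) (x : Fin (mW (n + 2)) → ℤ),
          θ n (QuotientAddGroup.mk' (Aadd (n + 1)).range x) = 0 →
          ∃ (b : ℕ) (y : Fin (mW (b + 2)) → ℤ),
            ITreach (n + 2) (b + 2) x y ∧ y ∈ (Aadd (b + 1)).range) →
      Nonempty (T ≃+ (ℤ × DirectSum ℕ (fun _ => ContinuousMap Kspace ℤ))) := by
  intro T _ θ hθ hsurj hker
  let ψ (n : ℕ) : (Fin (mW (n + 2)) → ℤ) →+ T :=
    (θ n).comp (QuotientAddGroup.mk' (Aadd (n + 1)).range)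
  have hψ : ∀ n x, ψ (n + 1) (ITadd (n + 2) x) = ψ n x := hθ
  have hA : ∀ n x, ψ n (Aadd (n + 1) x) = 0 := by
    intro n x
    have : QuotientAddGroup.mk' (Aadd (n + 1)).range (Aadd (n + 1) x) = 0 :=
      (QuotientAddGroup.eq_zero_iff _).2 ⟨x, rfl⟩
    exact (congrArg (θ n) this).trans (map_zero _)
  let t (L : List (Fin 2)) : T := ψ L.length (cyl (L.length + 2) L)
  have hmono : ∀ (L : List (Fin 2)) {n m : ℕ}, n ≤ m → L.length ≤ n + 2 →
      ψ m (cyl (m + 2) L) = ψ n (cyl (n + 2) L) := by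
    intro L n m hnm hL
    induction m, hnm using Nat.le_induction with
    | base => rfl
    | succ m hm ih => rw [← ih, ← hψ m, ITadd_cyl (by omega)]
  have htψ : ∀ (L : List (Fin 2)) (n : ℕ), L.length ≤ n + 2 → ψ n (cyl (n + 2) L) = t L := by
    intro L n hL
    rcases le_total n L.length with h | h
    · exact (hmono L h hL).symm
    · exact hmono L h (by omega)
  have ht : IsCylinderSystem t :=
    { eq_zero := fun L hL => by simp only [t, cyl_eq_zero hL, map_zero]
      split := fun L => by
        rw [← htψ L L.length (by omega), ← htψ (L ++ [0]) L.length (by simp),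
          ← htψ (L ++ [1]) L.length (by simp), cyl_split (by omega), map_add]
      rel_zero := fun L => by
        rw [← htψ (0 :: 0 :: L) L.length (by simp), ← htψ (1 :: 0 :: L) L.length (by simp),
          ← htψ (0 :: L) L.length (by simp), ← htψ L L.length (by omega), ← map_add, ← map_add,
          ← map_sub, ← Aadd_cyl_zero_cons le_rfl, hA]
      rel_one := by
        rw [← htψ [0, 1] 0 (by simp), ← htψ [0] 0 (by simp), ← htψ [1] 0 (by simp), ← map_add,
          ← map_sub, ← Aadd_cyl_one, hA]
      rel_one_zero := fun L => by
        rw [← htψ (0 :: 1 :: 0 :: L) (L.length + 1) (by simp),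
          ← htψ (0 :: L) (L.length + 1) (by simp),
          ← htψ (1 :: 0 :: L) (L.length + 1) (by simp), ← map_add, ← map_sub,
          ← Aadd_cyl_one_zero_cons le_rfl, hA] }
  have hs : Function.Surjective (fromNf t) := by
    intro y
    obtain ⟨n, x, rfl⟩ := hsurj y
    refine ⟨evalWords nf (n + 2) x, ?_⟩
    have : fromNf t ∘ₗ evalWords nf (n + 2) = (ψ n).toIntLinearMap := by
      refine linearMap_eq_of_cyl fun L hL => ?_
      rw [LinearMap.comp_apply, evalWords_cyl isCylinderSystem_nf hL.le, fromNf_nf ht]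
      exact (htψ L n hL.le).symm
    exact LinearMap.congr_fun this x
  have hi : Function.Injective (fromNf t) := by
    rw [injective_iff_map_eq_zero]
    intro g hg
    let n := g.support.sup fun i => i.toList.length
    have hn : ∀ i ∈ g.support, i.toList.length ≤ n + 2 := fun i hi =>
      (Finset.le_sup (f := fun i : BasisIndex => i.toList.length) hi).trans (Nat.le_add_right _ _)
    let x := ∑ i ∈ g.support, g i • cyl (n + 2) i.toList
    have hx : ψ n x = 0 := by
      rw [← hg, fromNf, Finsupp.linearCombination_apply, Finsupp.sum, map_sum (ψ n)]
      exact Finset.sum_congr rfl fun i hi => by rw [map_zsmul, htψ _ _ (hn i hi)]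
    have hxg : evalWords nf (n + 2) x = g := by
      conv_rhs => rw [← Finsupp.sum_single g]
      rw [Finsupp.sum, map_sum]
      refine Finset.sum_congr rfl fun i hi => ?_
      rw [map_zsmul, evalWords_cyl isCylinderSystem_nf (hn i hi), nf_toList, Finsupp.smul_single,
        smul_eq_mul, mul_one]
    obtain ⟨b, y, hxy, z, rfl⟩ := hker n x hx
    rw [← hxg, ← evalWords_eq_of_ITreach isCylinderSystem_nf hxy,
      evalWords_Aadd isCylinderSystem_nf]
  obtain ⟨e⟩ := nonempty_basisIndex_equiv
  exact ⟨(AddEquiv.ofBijective (fromNf t) ⟨hi, hs⟩).symm.trans e⟩
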